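/- arXiv:2207.02283 — 4 statements merged into one kernel-verified Lean document; each statement's English description precedes it below -/
import Mathlib

section
/- Let R be a commutative Noetherian ring and J an ideal of R contained in the Jacobson radical of R, and suppose R is J-adically complete. Let (M_n)_{n≥0} be a sequence of finitely generated R-modules together with R-linear transition maps f_n : M_{n+1} → M_n such that, for every n, the range of f_n is contained in J • M_n. Then the inverse limit of the system vanishes: if x_n ∈ M_n is a family satisfying f_n(x_{n+1}) = x_n for all n, then x_n = 0 for all n. -/
/-- **Vanishing of the inverse limit** (paper Lemma on limit vanishing, first part).
Let `R` be a commutative Noetherian ring, `J` an ideal contained in the Jacobson radical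
of `R`, with `R` `J`-adically complete.  Given an inverse system of finitely generated
`R`-modules `M n` with transition maps `f n : M (n+1) → M n` whose ranges land in
`J • M n`, every compatible sequence in the inverse limit vanishes. -/
theorem inverse_limit_vanishes_of_range_le_smul
    {R : Type*} [CommRing R] [IsNoetherianRing R] (J : Ideal R)
    (hJ : J ≤ Ideal.jacobson ⊥) [IsAdicComplete J R]
    (M : ℕ → Type*) [∀ n, AddCommGroup (M n)] [∀ n, Module R (M n)]
    [∀ n, Module.Finite R (M n)]
    (f : ∀ n, M (n + 1) →ₗ[R] M n)
    (hf : ∀ n, LinearMap.range (f n) ≤ J • (⊤ : Submodule R (M n)))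
    (x : ∀ n, M n) (hx : ∀ n, f n (x (n + 1)) = x n) :
    ∀ n, x n = 0 := by
  have key : ∀ k n, x n ∈ J ^ k • (⊤ : Submodule R (M n)) := by
    intro k
    induction k with
    | zero => intro n; simp
    | succ k ih =>
      intro n
      have h1 : f n (x (n + 1)) ∈ (J ^ k • (⊤ : Submodule R (M (n + 1)))).map (f n) :=
        Submodule.mem_map_of_mem (ih (n + 1))
      rw [hx, Submodule.map_smul'', Submodule.map_top] at h1
      rw [pow_succ, Submodule.mul_smul]
      exact Submodule.smul_mono le_rfl (hf n) h1
  intro n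
  have h := Ideal.iInf_pow_smul_eq_bot_of_le_jacobson (M := M n) J hJ
  rw [← Submodule.mem_bot R, ← h, Submodule.mem_iInf]
  exact fun k => key k n
end

section
/- Let R be a commutative Noetherian ring and J an ideal of R contained in the Jacobson radical of R, and suppose R is J-adically complete. Let (M_n)_{n≥0} be a sequence of finitely generated R-modules together with R-linear transition maps f_n : M_{n+1} → M_n such that, for every n, the range of f_n is contained in J • M_n. Then the derived inverse limit lim¹ of the system vanishes; concretely, the map τ : ∏_n M_n → ∏_n M_n defined by τ(α)_n = α_n − f_n(α_{n+1}) is surjective. -/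
theorem aux_isPrecomplete {R : Type*} [CommRing R] (J : Ideal R) [IsAdicComplete J R]
    (N : Type*) [AddCommGroup N] [Module R N] [Module.Finite R N] : IsPrecomplete J N := by
  rw [← AdicCompletion.of_surjective_iff]
  intro x
  obtain ⟨t, rfl⟩ := AdicCompletion.ofTensorProduct_surjective_of_finite J N x
  induction t using TensorProduct.induction_on with
  | zero => exact ⟨0, by simp⟩
  | add a b ha hb =>
    obtain ⟨a', ha⟩ := ha
    obtain ⟨b', hb⟩ := hb
    exact ⟨a' + b', by rw [map_add, map_add, ha, hb]⟩
  | tmul r m =>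
    obtain ⟨s, rfl⟩ := AdicCompletion.of_surjective J R r
    refine ⟨s • m, ?_⟩
    rw [AdicCompletion.ofTensorProduct_tmul]
    ext n
    rfl

/-- Partial sums of the series solving `α - f α = β`. -/
def auxPartial {R : Type*} [CommRing R]
    (M : ℕ → Type*) [∀ n, AddCommGroup (M n)] [∀ n, Module R (M n)]
    (f : ∀ n, M (n + 1) →ₗ[R] M n) (β : ∀ n, M n) : ℕ → ∀ n, M n
  | 0 => fun _ => 0
  | k + 1 => fun n => β n + f n (auxPartial M f β k (n + 1))

/-- **Vanishing of `lim¹`** (paper Lemma on limit vanishing, second part).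
Let `R` be a commutative Noetherian ring, `J` an ideal contained in the Jacobson radical
of `R`, with `R` `J`-adically complete.  Given an inverse system of finitely generated
`R`-modules `M n` with transition maps `f n : M (n+1) → M n` whose ranges land in
`J • M n`, the derived inverse limit `lim¹` vanishes: the map
`τ : ∏ n, M n → ∏ n, M n`, `τ(α)_n = α_n − f_n (α_{n+1})`, is surjective. -/
theorem derived_limit_vanishes_of_range_le_smul
    {R : Type*} [CommRing R] [IsNoetherianRing R] (J : Ideal R)
    (hJ : J ≤ Ideal.jacobson ⊥) [IsAdicComplete J R]
    (M : ℕ → Type*) [∀ n, AddCommGroup (M n)] [∀ n, Module R (M n)]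
    [∀ n, Module.Finite R (M n)]
    (f : ∀ n, M (n + 1) →ₗ[R] M n)
    (hf : ∀ n, LinearMap.range (f n) ≤ J • (⊤ : Submodule R (M n))) :
    Function.Surjective (fun α : ∀ n, M n => fun n => α n - f n (α (n + 1))) := by
  have hprec : ∀ n, IsPrecomplete J (M n) := fun n => aux_isPrecomplete J (M n)
  have hhaus : ∀ n, IsHausdorff J (M n) := fun n => IsHausdorff.of_le_jacobson J (M n) hJ
  have hmap : ∀ k n (x : M (n + 1)), x ∈ (J ^ k • ⊤ : Submodule R (M (n + 1))) →
      f n x ∈ (J ^ (k + 1) • ⊤ : Submodule R (M n)) := by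
    intro k n x hx
    have h1 : f n x ∈ (J ^ k • ⊤ : Submodule R (M (n + 1))).map (f n) :=
      Submodule.mem_map_of_mem hx
    rw [Submodule.map_smul'', Submodule.map_top] at h1
    rw [pow_succ, Submodule.mul_smul]
    exact Submodule.smul_mono le_rfl (hf n) h1
  intro β
  have hstep : ∀ k n, auxPartial M f β (k + 1) n - auxPartial M f β k n ∈
      (J ^ k • ⊤ : Submodule R (M n)) := by
    intro k
    induction k with
    | zero => intro n; simp
    | succ k ih =>
      intro n
      have h := hmap k n _ (ih (n + 1))
      rw [map_sub] at h
      change (β n + f n (auxPartial M f β (k + 1) (n + 1))) -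
        (β n + f n (auxPartial M f β k (n + 1))) ∈ _
      rwa [add_sub_add_left_eq_sub]
  have hcauchy : ∀ n {a b : ℕ}, a ≤ b → auxPartial M f β a n ≡ auxPartial M f β b n
      [SMOD (J ^ a • ⊤ : Submodule R (M n))] := by
    intro n a b hab
    induction b, hab using Nat.le_induction with
    | base => rfl
    | succ b hab ih =>
      refine ih.trans (SModEq.symm (SModEq.sub_mem.mpr ?_))
      exact Submodule.smul_mono_left (Ideal.pow_le_pow_right hab) (hstep b n)
  choose α hα using fun n => (hprec n).prec' (fun k => auxPartial M f β k n) (hcauchy n)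
  refine ⟨α, funext fun n => ?_⟩
  rw [← sub_eq_zero]
  refine (hhaus n).haus _ fun k => ?_
  rw [SModEq.zero]
  have h1 := SModEq.sub_mem.mp (hα n (k + 1))
  have h2 := hmap k n _ (SModEq.sub_mem.mp (hα (n + 1) k))
  have h3 := Submodule.smul_mono_left (N := (⊤ : Submodule R (M n)))
    (Ideal.pow_le_pow_right (I := J) (Nat.le_succ k)) (Submodule.sub_mem _ h2 h1)
  convert h3 using 1
  rw [map_sub]
  simp only [auxPartial]
  abel
end

section
/- Let R be a commutative ring, p a prime number, G a group, and H, K subgroups of G such that x^p ∈ K for every x ∈ H. In the group algebra A = MonoidAlgebra R G, let I_H, I_K, and I denote the left ideals generated by the sets {x − 1 : x ∈ H}, {x − 1 : x ∈ K}, and {g − 1 : g ∈ G}, respectively (group elements being identified with their images in A). Then p • I_H is contained in J + I_K, where J is the left ideal of A generated by all products a * b with a ∈ I_H and b ∈ I. -/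
/-- (Group-ring form of Lemma `pcoker` of the paper.)
Let `R` be a commutative ring, `p` a prime, `G` a group and `H, K` subgroups with
`x^p ∈ K` for every `x ∈ H`.  In the group algebra `A = MonoidAlgebra R G`, let
`I_H`, `I_K`, `I` be the left ideals generated by `{x − 1 : x ∈ H}`, `{x − 1 : x ∈ K}`
and `{g − 1 : g ∈ G}` respectively, and `J` the left ideal generated by the products
`a * b` with `a ∈ I_H`, `b ∈ I`.  Then `p • I_H ⊆ J + I_K`. -/
theorem p_smul_augmentation_subideal_le
    {R : Type*} [CommRing R] (p : ℕ) (hp : p.Prime)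
    {G : Type*} [Group G] (H K : Subgroup G) (hHK : ∀ x ∈ H, x ^ p ∈ K)
    (IH IK I J : Ideal (MonoidAlgebra R G))
    (hIH : IH = Ideal.span {a : MonoidAlgebra R G | ∃ x ∈ H, a = MonoidAlgebra.of R G x - 1})
    (hIK : IK = Ideal.span {a : MonoidAlgebra R G | ∃ x ∈ K, a = MonoidAlgebra.of R G x - 1})
    (hI : I = Ideal.span {a : MonoidAlgebra R G | ∃ g : G, a = MonoidAlgebra.of R G g - 1})
    (hJ : J = Ideal.span {c : MonoidAlgebra R G | ∃ a ∈ IH, ∃ b ∈ I, c = a * b}) :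
    ∀ a ∈ IH, (p : MonoidAlgebra R G) * a ∈ J ⊔ IK := by
  have key : ∀ x ∈ H, ∀ n : ℕ, MonoidAlgebra.of R G x ^ n - 1
      - (n : MonoidAlgebra R G) * (MonoidAlgebra.of R G x - 1) ∈ J := by
    intro x hx n
    induction n with
    | zero => simp
    | succ n ih =>
      have h1 : (MonoidAlgebra.of R G x ^ n - 1) * (MonoidAlgebra.of R G x - 1) ∈ J := by
        rw [hJ]
        refine Ideal.subset_span ⟨_, ?_, _, ?_, rfl⟩
        · rw [hIH]
          exact Ideal.subset_span ⟨x ^ n, H.pow_mem hx n, by rw [map_pow]⟩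
        · rw [hI]
          exact Ideal.subset_span ⟨x, rfl⟩
      have h2 := J.add_mem ih h1
      convert h2 using 1
      push_cast
      rw [pow_succ]
      noncomm_ring
  intro a ha
  rw [hIH] at ha
  induction ha using Submodule.span_induction with
  | mem a h =>
    obtain ⟨x, hx, rfl⟩ := h
    have h1 : MonoidAlgebra.of R G x ^ p - 1 ∈ IK := by
      rw [hIK]
      exact Ideal.subset_span ⟨x ^ p, hHK x hx, by rw [map_pow]⟩
    have h2 := (J ⊔ IK).sub_mem (Submodule.mem_sup_right h1)
      (Submodule.mem_sup_left (key x hx p))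
    rwa [sub_sub_cancel] at h2
  | zero => simp
  | add a b _ _ iha ihb =>
    rw [mul_add]
    exact add_mem iha ihb
  | smul r a _ ih =>
    rw [smul_eq_mul, ← mul_assoc, (Nat.cast_commute p r).eq, mul_assoc]
    exact Ideal.mul_mem_left _ r ih
end

section
/- Let W be a commutative ring, G a finite group, A = MonoidAlgebra W G, and let M and M' be left A-modules. Let B : M → M' → W be a W-bilinear pairing such that: (a) B(g • x, y) = B(x, g⁻¹ • y) for all g ∈ G, x ∈ M, y ∈ M'; and (b) the map M → Hom_W(M', W) sending x to B(x, ·) is bijective. For x ∈ M define P x : M' → A by (P x)(y) = Σ_{g ∈ G} B(x, g⁻¹ • y) • g, where g is viewed in A. Then: (1) for every x ∈ M, P x is a homomorphism of left A-modules from M' to A; (2) the map x ↦ P x is a bijection from M onto the set of all left A-module homomorphisms M' → A; and (3) for all g₀ ∈ G, x ∈ M, y ∈ M', one has P(g₀ • x)(y) = (P x)(y) * g₀⁻¹ in A. -/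
/-- (Abstract form of Proposition `prop:NCDual` of the paper, at a finite level.)
Let `W` be a commutative ring, `G` a finite group, `A = MonoidAlgebra W G`, and `M`, `M'`
left `A`-modules.  Let `B` be a `W`-bilinear pairing `M × M' → W` such that
`B(g • x, y) = B(x, g⁻¹ • y)` and such that `x ↦ B(x, ·)` is a bijection onto
`Hom_W(M', W)`.  Define `P x : M' → A` by `(P x)(y) = Σ_{g ∈ G} B(x, g⁻¹ • y) • g`.
Then each `P x` is a left `A`-module homomorphism `M' → A`, the map `x ↦ P x` is a
bijection from `M` onto the set of left `A`-module homomorphisms `M' → A`, and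
`P (g₀ • x) (y) = (P x)(y) * g₀⁻¹`. -/
theorem pairing_to_dual_bijection
    {W : Type*} [CommRing W] {G : Type*} [Group G] [Fintype G]
    {M M' : Type*} [AddCommGroup M] [Module W M] [AddCommGroup M'] [Module W M']
    [Module (MonoidAlgebra W G) M] [IsScalarTower W (MonoidAlgebra W G) M]
    [Module (MonoidAlgebra W G) M'] [IsScalarTower W (MonoidAlgebra W G) M']
    (B : M →ₗ[W] M' →ₗ[W] W)
    (hadj : ∀ (g : G) (x : M) (y : M'),
      B (MonoidAlgebra.of W G g • x) y = B x (MonoidAlgebra.of W G g⁻¹ • y))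
    (hperf : Function.Bijective fun x : M => (B x : M' →ₗ[W] W))
    (P : M → M' → MonoidAlgebra W G)
    (hP : ∀ (x : M) (y : M'),
      P x y = ∑ g : G, B x (MonoidAlgebra.of W G g⁻¹ • y) • MonoidAlgebra.of W G g) :
    (∀ (x : M) (y₁ y₂ : M'), P x (y₁ + y₂) = P x y₁ + P x y₂) ∧
    (∀ (x : M) (a : MonoidAlgebra W G) (y : M'), P x (a • y) = a * P x y) ∧
    (Function.Injective P) ∧
    (∀ φ : M' →ₗ[MonoidAlgebra W G] MonoidAlgebra W G, ∃ x : M, ∀ y : M', φ y = P x y) ∧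
    (∀ (g₀ : G) (x : M) (y : M'),
      P (MonoidAlgebra.of W G g₀ • x) y = P x y * MonoidAlgebra.of W G g₀⁻¹) := by
  classical
  have hc : ∀ (x : M) (y : M') (h : G),
      (P x y).coeff h = B x (MonoidAlgebra.of W G h⁻¹ • y) := by
    intro x y h
    rw [hP]
    simp [MonoidAlgebra.coeff_sum, MonoidAlgebra.of_apply, MonoidAlgebra.coeff_single,
      Finsupp.single_apply]
  have hext : ∀ a b : MonoidAlgebra W G, (∀ h, a.coeff h = b.coeff h) → a = b :=
    fun a b h => MonoidAlgebra.coeff_injective (Finsupp.ext h)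
  have : SMulCommClass W (MonoidAlgebra W G) M' := IsScalarTower.to_smulCommClass
  have hadd : ∀ (x : M) (y₁ y₂ : M'), P x (y₁ + y₂) = P x y₁ + P x y₂ := by
    intro x y₁ y₂
    apply hext
    intro h
    rw [MonoidAlgebra.coeff_add, Finsupp.add_apply, hc, hc, hc, smul_add, map_add]
  refine ⟨hadd, ?_, ?_, ?_, ?_⟩
  · intro x a y
    induction a using MonoidAlgebra.induction_on with
    | of g =>
      apply hext
      intro h
      rw [hc, ← mul_smul, ← map_mul, MonoidAlgebra.of_apply W G g,
        MonoidAlgebra.coeff_single_mul_apply, hc, one_mul, mul_inv_rev, inv_inv]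
    | add a b ha hb => rw [add_smul, hadd, ha, hb, add_mul]
    | smul r a ha =>
      rw [smul_assoc, smul_mul_assoc, ← ha]
      apply hext
      intro h
      rw [MonoidAlgebra.coeff_smul_apply, hc, hc, smul_comm, map_smul]
  · intro x₁ x₂ h
    apply hperf.1
    ext y
    have := congrArg (fun a => a.coeff 1) (congrFun h y)
    simpa only [hc, inv_one, map_one, one_smul] using this
  · intro φ
    let ψ : M' →ₗ[W] W :=
      { toFun := fun y => (φ y).coeff 1
        map_add' := fun a b => by simp
        map_smul' := fun r a => by
          have : φ (r • a) = r • φ a := φ.map_smul_of_tower r a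
          simp [this] }
    obtain ⟨x, hx⟩ := hperf.2 ψ
    refine ⟨x, fun y => hext _ _ fun h => ?_⟩
    have hx' : B x = ψ := hx
    rw [hc, hx']
    change _ = (φ (MonoidAlgebra.of W G h⁻¹ • y)).coeff 1
    rw [map_smul, smul_eq_mul, MonoidAlgebra.of_apply,
      MonoidAlgebra.coeff_single_mul_apply]
    simp
  · intro g₀ x y
    apply hext
    intro h
    rw [hc, hadj, MonoidAlgebra.of_apply W G g₀⁻¹, MonoidAlgebra.coeff_mul_single_apply, hc,
      ← MonoidAlgebra.of_apply, ← mul_smul, ← map_mul, mul_one, mul_inv_rev, inv_inv]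
end
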